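/- Let d ≥ 3 be an integer and Ω ⊂ ℝ^d a bounded domain with C² boundary. Then lim_{a → 0⁺} Φ(Ω, a) = κ · ∫_{∂Ω}∫_{∂Ω} |ν(x) − ν(y)|² / |x − y|^{d−1} dσ(x) dσ(y), where κ := (2π)^{−d/2} ∫_0^{+∞} t^{d/2−1} K_{d/2−1}(t) dt. -/

import Mathlib

open MeasureTheory Metric Set Filter
open scoped RealInnerProductSpace Topology ENNReal

noncomputable section

/-- The modified Bessel function of the second kind of order `α`:
`K_α(t) = ∫_0^∞ exp (-t cosh r) cosh (α r) dr`. -/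
def besselK (α t : ℝ) : ℝ :=
  ∫ r in Set.Ioi (0:ℝ), Real.exp (-t * Real.cosh r) * Real.cosh (α * r)

/-- `G(x) = (2π)^{-d/2} |x|^{1-d/2} K_{d/2-1}(|x|)`. -/
def Gfun (d : ℕ) (x : EuclideanSpace ℝ (Fin d)) : ℝ :=
  (2 * Real.pi) ^ (-(d:ℝ)/2) * ‖x‖ ^ (1 - (d:ℝ)/2) * besselK ((d:ℝ)/2 - 1) ‖x‖

/-- `H(x) = (2π)^{-d/2} |x|^{1-d/2} K'_{d/2-1}(|x|)`. -/
def Hfun (d : ℕ) (x : EuclideanSpace ℝ (Fin d)) : ℝ :=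
  (2 * Real.pi) ^ (-(d:ℝ)/2) * ‖x‖ ^ (1 - (d:ℝ)/2) * deriv (besselK ((d:ℝ)/2 - 1)) ‖x‖

/-- `W(x) = (2π)^{-d/2} ∫_{|x|}^∞ t^{d/2-1} K_{d/2-1}(t) dt`. -/
def Wfun (d : ℕ) (x : EuclideanSpace ℝ (Fin d)) : ℝ :=
  (2 * Real.pi) ^ (-(d:ℝ)/2) * ∫ t in Set.Ioi ‖x‖, t ^ ((d:ℝ)/2 - 1) * besselK ((d:ℝ)/2 - 1) t

/-- `F(x) = (1 - d/2) G(x)/|x| - H(x)`. -/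
def Ffun (d : ℕ) (x : EuclideanSpace ℝ (Fin d)) : ℝ :=
  (1 - (d:ℝ)/2) * Gfun d x / ‖x‖ - Hfun d x

/-- The Bessel potential `G_a(x) = a^{d-2} G(ax)`. -/
def Ga (d : ℕ) (a : ℝ) (x : EuclideanSpace ℝ (Fin d)) : ℝ := a ^ ((d:ℝ) - 2) * Gfun d (a • x)

/-- `H_a(x) = a^{d-2} H(ax)`. -/
def Ha (d : ℕ) (a : ℝ) (x : EuclideanSpace ℝ (Fin d)) : ℝ := a ^ ((d:ℝ) - 2) * Hfun d (a • x)

/-- `W_a(x) = W(ax)`. -/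
def Wa (d : ℕ) (a : ℝ) (x : EuclideanSpace ℝ (Fin d)) : ℝ := Wfun d (a • x)

/-- `F_a(x) = a^d F(ax)`. -/
def Fa (d : ℕ) (a : ℝ) (x : EuclideanSpace ℝ (Fin d)) : ℝ := a ^ (d:ℝ) * Ffun d (a • x)

/-- `Ω ⊂ ℝ^d` is a bounded domain (open, connected, bounded) with `C²` boundary:
near every boundary point, `Ω` and `∂Ω` are the sublevel/level set of a `C²` defining
function with nonvanishing differential. -/
def IsBoundedC2Domain {d : ℕ} (Ω : Set (EuclideanSpace ℝ (Fin d))) : Prop :=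
  IsOpen Ω ∧ IsConnected Ω ∧ Bornology.IsBounded Ω ∧
    ∀ x ∈ frontier Ω, ∃ (U : Set (EuclideanSpace ℝ (Fin d))) (f : EuclideanSpace ℝ (Fin d) → ℝ),
      IsOpen U ∧ x ∈ U ∧ ContDiff ℝ 2 f ∧ (∀ y ∈ U, fderiv ℝ f y ≠ 0) ∧
      Ω ∩ U = {y ∈ U | f y < 0} ∧ frontier Ω ∩ U = {y ∈ U | f y = 0}

/-- `ν` is the outward unit normal vector field on `∂Ω`. -/
def IsOutwardUnitNormal {d : ℕ} (Ω : Set (EuclideanSpace ℝ (Fin d)))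
    (ν : EuclideanSpace ℝ (Fin d) → EuclideanSpace ℝ (Fin d)) : Prop :=
  ∀ x ∈ frontier Ω, ‖ν x‖ = 1 ∧
    ∃ ε > 0, ∀ t : ℝ, t ∈ Set.Ioo 0 ε → x + t • ν x ∉ closure Ω ∧ x - t • ν x ∈ Ω

/-- `Ω` is an (open) ball. -/
def IsBall {d : ℕ} (Ω : Set (EuclideanSpace ℝ (Fin d))) : Prop :=
  ∃ (c : EuclideanSpace ℝ (Fin d)) (r : ℝ), 0 < r ∧ Ω = Metric.ball c r

/-- `κ = (2π)^{-d/2} ∫_0^∞ t^{d/2-1} K_{d/2-1}(t) dt`. -/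
def kappa (d : ℕ) : ℝ :=
  (2 * Real.pi) ^ (-(d:ℝ)/2) * ∫ t in Set.Ioi (0:ℝ), t ^ ((d:ℝ)/2 - 1) * besselK ((d:ℝ)/2 - 1) t

/-- `κ̃ = ∫_{S^{d-1}} |x - e|^{3-d} dσ(x)`. -/
def sphereInt (d : ℕ) (e : EuclideanSpace ℝ (Fin d)) : ℝ :=
  ∫ x in Metric.sphere (0 : EuclideanSpace ℝ (Fin d)) 1, ‖x - e‖ ^ ((3:ℝ) - d) ∂μH[(d:ℝ)-1]

/-- The double boundary integral `∫_{∂Ω}∫_{∂Ω} |ν(x)-ν(y)|²/|x-y|^{d-1} dσ(x) dσ(y)`. -/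
def nuSqInt (d : ℕ) (Ω : Set (EuclideanSpace ℝ (Fin d)))
    (ν : EuclideanSpace ℝ (Fin d) → EuclideanSpace ℝ (Fin d)) : ℝ :=
  ∫ x in frontier Ω, (∫ y in frontier Ω,
      ‖ν x - ν y‖ ^ 2 / ‖x - y‖ ^ ((d:ℝ) - 1) ∂μH[(d:ℝ)-1]) ∂μH[(d:ℝ)-1]

/-- The nonlocal perimeter `Λ(Ω,a) = ∫_{Ω^c}∫_Ω G_a(x-y) dx dy`. -/
def Lam (d : ℕ) (Ω : Set (EuclideanSpace ℝ (Fin d))) (a : ℝ) : ℝ :=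
  ∫ x in Ωᶜ, ∫ y in Ω, Ga d a (x - y)

/-- `Φ(Ω,a)`, written in terms of `W_a` and `F_a`. -/
def Phi (d : ℕ) (Ω : Set (EuclideanSpace ℝ (Fin d)))
    (ν : EuclideanSpace ℝ (Fin d) → EuclideanSpace ℝ (Fin d)) (a : ℝ) : ℝ :=
  (∫ x in frontier Ω, (∫ y in frontier Ω,
      Wa d a (x - y) * ‖ν x - ν y‖ ^ 2 / ‖x - y‖ ^ ((d:ℝ) - 1) ∂μH[(d:ℝ)-1]) ∂μH[(d:ℝ)-1])
  + 4 * ∫ x in Ωᶜ, ∫ y in Ω, Fa d a (x - y) / ‖x - y‖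

section Bessel

lemma exp_half_le_cosh (s : ℝ) : Real.exp s / 2 ≤ Real.cosh s := by
  rw [Real.cosh_eq]
  have := Real.exp_pos (-s)
  linarith

lemma cosh_mul_le_exp {α s : ℝ} (hα : 0 ≤ α) (hs : 0 ≤ s) :
    Real.cosh (α * s) ≤ Real.exp (α * s) := by
  rw [Real.cosh_eq]
  have : Real.exp (-(α * s)) ≤ Real.exp (α * s) :=
    Real.exp_le_exp.2 (by have := mul_nonneg hα hs; linarith)
  linarith

lemma abs_sinh_mul_le_exp {α s : ℝ} (hα : 0 ≤ α) (hs : 0 ≤ s) :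
    |Real.sinh (α * s)| ≤ Real.exp (α * s) := by
  have h0 := mul_nonneg hα hs
  rw [abs_of_nonneg (Real.sinh_nonneg_iff.2 h0)]
  exact (Real.sinh_lt_cosh _).le.trans (cosh_mul_le_exp hα hs)

lemma exp_neg_mul_cosh_mul_exp_le {t : ℝ} (ht : 0 < t) (m : ℝ) {s : ℝ} (hs : 0 ≤ s) :
    Real.exp (-t * Real.cosh s) * Real.exp (m * s)
      ≤ Real.exp ((m + 1) ^ 2 / t) * Real.exp (-s) := by
  rw [← Real.exp_add, ← Real.exp_add, Real.exp_le_exp]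
  have h1 : s ^ 2 / 4 ≤ Real.cosh s := by
    have := exp_half_le_cosh s
    have := Real.quadratic_le_exp_of_nonneg hs
    nlinarith
  have h2 : (m + 1) * s ≤ t * (s ^ 2 / 4) + (m + 1) ^ 2 / t := by
    have h3 : t * (s ^ 2 / 4) + (m + 1) ^ 2 / t - (m + 1) * s
        = (t * s / 2 - (m + 1)) ^ 2 / t := by
      field_simp
      ring
    have h4 : 0 ≤ (t * s / 2 - (m + 1)) ^ 2 / t := by positivity
    linarith
  have h5 := mul_le_mul_of_nonneg_left h1 ht.le
  linarith

lemma integrableOn_exp_neg_mul_cosh_mul {t : ℝ} (ht : 0 < t) {f : ℝ → ℝ} (hf : Continuous f)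
    (m : ℝ) (hfm : ∀ s, 0 ≤ s → |f s| ≤ Real.exp (m * s)) :
    IntegrableOn (fun s => Real.exp (-t * Real.cosh s) * f s) (Ioi 0) := by
  have hb : IntegrableOn (fun s : ℝ => Real.exp ((m + 1) ^ 2 / t) * Real.exp (-s)) (Ioi 0) :=
    (integrableOn_exp_neg_Ioi 0).const_mul _
  refine Integrable.mono' hb ?_ ?_
  · exact Continuous.aestronglyMeasurable (by fun_prop)
  · filter_upwards [ae_restrict_mem measurableSet_Ioi] with s hs
    have hs' : 0 ≤ s := le_of_lt hs
    rw [norm_mul, Real.norm_eq_abs, Real.norm_eq_abs, abs_of_pos (Real.exp_pos _)]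
    exact (mul_le_mul_of_nonneg_left (hfm s hs') (Real.exp_pos _).le).trans
      (exp_neg_mul_cosh_mul_exp_le ht m hs')

lemma integrableOn_besselK_integrand (α : ℝ) {t : ℝ} (ht : 0 < t) :
    IntegrableOn (fun s => Real.exp (-t * Real.cosh s) * Real.cosh (α * s)) (Ioi 0) := by
  refine integrableOn_exp_neg_mul_cosh_mul ht (by fun_prop) |α| fun s hs => ?_
  rw [abs_of_pos (Real.cosh_pos _), ← Real.cosh_abs, abs_mul, abs_of_nonneg hs]
  exact cosh_mul_le_exp (abs_nonneg α) hs

lemma besselK_pos (α : ℝ) {t : ℝ} (ht : 0 < t) : 0 < besselK α t := by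
  unfold besselK
  rw [setIntegral_pos_iff_support_of_nonneg_ae]
  · have : Function.support (fun s => Real.exp (-t * Real.cosh s) * Real.cosh (α * s)) = univ := by
      ext s
      simp [(Real.cosh_pos _).ne']
    rw [this, univ_inter, Real.volume_Ioi]
    exact ENNReal.zero_lt_top
  · exact ae_of_all _ fun s => by have := Real.cosh_pos (α * s); positivity
  · exact integrableOn_besselK_integrand α ht

lemma besselK_mono {α β t : ℝ} (h : |β| ≤ |α|) (ht : 0 < t) : besselK β t ≤ besselK α t := by
  refine setIntegral_mono_on (integrableOn_besselK_integrand β ht)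
    (integrableOn_besselK_integrand α ht) measurableSet_Ioi fun s _ => ?_
  refine mul_le_mul_of_nonneg_left (Real.cosh_le_cosh.2 ?_) (Real.exp_pos _).le
  rw [abs_mul, abs_mul]
  exact mul_le_mul_of_nonneg_right h (abs_nonneg s)

lemma stronglyMeasurable_besselK (α : ℝ) : StronglyMeasurable (besselK α) := by
  have : Continuous (fun p : ℝ × ℝ => Real.exp (-p.1 * Real.cosh p.2) * Real.cosh (α * p.2)) := by
    fun_prop
  exact this.stronglyMeasurable.integral_prod_right'

lemma integrableOn_besselK_deriv_integrand {α : ℝ} (hα : 0 ≤ α) {t : ℝ} (ht : 0 < t) :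
    IntegrableOn (fun s => Real.exp (-t * Real.cosh s) * (Real.cosh s * Real.cosh (α * s)))
      (Ioi 0) := by
  refine integrableOn_exp_neg_mul_cosh_mul ht (by fun_prop) (1 + α) fun s hs => ?_
  rw [abs_mul, abs_of_pos (Real.cosh_pos _), abs_of_pos (Real.cosh_pos _), add_mul, Real.exp_add]
  have := cosh_mul_le_exp zero_le_one hs
  rw [one_mul] at this ⊢
  gcongr
  exact cosh_mul_le_exp hα hs

lemma integrableOn_sinh_mul_sinh {α : ℝ} (hα : 0 ≤ α) {t : ℝ} (ht : 0 < t) :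
    IntegrableOn (fun s => Real.exp (-t * Real.cosh s) * (Real.sinh s * Real.sinh (α * s)))
      (Ioi 0) := by
  refine integrableOn_exp_neg_mul_cosh_mul ht (by fun_prop) (1 + α) fun s hs => ?_
  rw [abs_mul, add_mul, Real.exp_add]
  have := abs_sinh_mul_le_exp zero_le_one hs
  rw [one_mul] at this ⊢
  gcongr
  exact abs_sinh_mul_le_exp hα hs

lemma hasDerivAt_besselK {α : ℝ} (hα : 0 ≤ α) {t : ℝ} (ht : 0 < t) :
    HasDerivAt (besselK α)
      (-∫ s in Ioi (0 : ℝ), Real.exp (-t * Real.cosh s) * (Real.cosh s * Real.cosh (α * s))) t := by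
  rw [← integral_neg]
  refine (hasDerivAt_integral_of_dominated_loc_of_deriv_le (μ := volume.restrict (Ioi (0 : ℝ)))
    (F := fun t s => Real.exp (-t * Real.cosh s) * Real.cosh (α * s))
    (F' := fun t s => -(Real.exp (-t * Real.cosh s) * (Real.cosh s * Real.cosh (α * s))))
    (bound := fun s => Real.exp (-(t / 2) * Real.cosh s) * (Real.cosh s * Real.cosh (α * s)))
    (Ioi_mem_nhds (half_lt_self ht)) ?_ (integrableOn_besselK_integrand α ht) ?_ ?_
    (integrableOn_besselK_deriv_integrand hα (half_pos ht)) ?_).2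
  · exact Eventually.of_forall fun u => Continuous.aestronglyMeasurable (by fun_prop)
  · exact Continuous.aestronglyMeasurable (by fun_prop)
  · refine ae_of_all _ fun s u hu => ?_
    have h1 := Real.cosh_pos s
    have h2 := Real.cosh_pos (α * s)
    rw [norm_neg, Real.norm_of_nonneg (by positivity)]
    have hu' : t / 2 < u := hu
    gcongr
  · refine ae_of_all _ fun s u _ => ?_
    have h := (((hasDerivAt_id u).neg.mul_const (Real.cosh s)).exp).mul_const (Real.cosh (α * s))
    refine h.congr_deriv ?_
    simp only [Pi.neg_apply, id_eq]
    ring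

/-- Integration by parts: `α K_α(t) = t ∫ e^{-t cosh s} sinh s sinh (α s) ds`. -/
lemma mul_besselK_eq {α : ℝ} (hα : 0 ≤ α) {t : ℝ} (ht : 0 < t) :
    α * besselK α t =
      t * ∫ s in Ioi (0 : ℝ), Real.exp (-t * Real.cosh s) * (Real.sinh s * Real.sinh (α * s)) := by
  have hd : ∀ s ∈ Ici (0 : ℝ), HasDerivAt (fun s => Real.exp (-t * Real.cosh s) * Real.sinh (α * s))
      (α * (Real.exp (-t * Real.cosh s) * Real.cosh (α * s))
        - t * (Real.exp (-t * Real.cosh s) * (Real.sinh s * Real.sinh (α * s)))) s := by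
    intro s _
    have h := (((Real.hasDerivAt_cosh s).const_mul (-t)).exp).mul
      (((hasDerivAt_id s).const_mul α).sinh)
    refine h.congr_deriv ?_
    simp only [id_eq]
    ring
  have hi1 := (integrableOn_besselK_integrand α ht).const_mul α
  have hi2 := (integrableOn_sinh_mul_sinh hα ht).const_mul t
  have hlim : Tendsto (fun s => Real.exp (-t * Real.cosh s) * Real.sinh (α * s)) atTop (𝓝 0) := by
    have h0 : Tendsto (fun s : ℝ => Real.exp ((α + 1) ^ 2 / t) * Real.exp (-s)) atTop (𝓝 0) := by
      simpa using (Real.tendsto_exp_neg_atTop_nhds_zero).const_mul (Real.exp ((α + 1) ^ 2 / t))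
    refine squeeze_zero_norm' ?_ h0
    filter_upwards [eventually_ge_atTop 0] with s hs
    rw [norm_mul, Real.norm_eq_abs, Real.norm_eq_abs, abs_of_pos (Real.exp_pos _)]
    exact (mul_le_mul_of_nonneg_left (abs_sinh_mul_le_exp hα hs) (Real.exp_pos _).le).trans
      (exp_neg_mul_cosh_mul_exp_le ht α hs)
  have h := integral_Ioi_of_hasDerivAt_of_tendsto' hd (hi1.sub hi2) hlim
  rw [integral_sub hi1 hi2, integral_const_mul, integral_const_mul] at h
  simp only [mul_zero, Real.sinh_zero, sub_zero] at h
  unfold besselK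
  linarith

/-- The recurrence `-K_α'(t) - (α / t) K_α(t) = K_{α-1}(t)`. -/
lemma neg_deriv_besselK_sub {α : ℝ} (hα : 0 ≤ α) {t : ℝ} (ht : 0 < t) :
    -deriv (besselK α) t - α / t * besselK α t = besselK (α - 1) t := by
  have h : α / t * besselK α t =
      ∫ s in Ioi (0 : ℝ), Real.exp (-t * Real.cosh s) * (Real.sinh s * Real.sinh (α * s)) := by
    rw [div_mul_eq_mul_div, mul_besselK_eq hα ht, mul_div_cancel_left₀ _ ht.ne']
  rw [(hasDerivAt_besselK hα ht).deriv, neg_neg, h, ← integral_sub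
    (integrableOn_besselK_deriv_integrand hα ht) (integrableOn_sinh_mul_sinh hα ht)]
  refine integral_congr_ae (ae_of_all _ fun s => ?_)
  have : Real.cosh ((α - 1) * s) =
      Real.cosh (α * s) * Real.cosh s - Real.sinh (α * s) * Real.sinh s := by
    rw [sub_mul, one_mul, Real.cosh_sub]
  simp only [this]
  ring

lemma integrableOn_rpow_mul_besselK {α : ℝ} (hα : 0 ≤ α) :
    IntegrableOn (fun t => t ^ α * besselK α t) (Ioi 0) := by
  set μ := volume.restrict (Ioi (0 : ℝ))
  let f : ℝ × ℝ → ℝ := fun p => p.1 ^ α * (Real.exp (-p.1 * Real.cosh p.2) * Real.cosh (α * p.2))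
  have hfc : Measurable f := by fun_prop
  have hslice : ∀ s : ℝ, IntegrableOn (fun t => f (t, s)) (Ioi 0) ∧
      ∫ t in Ioi (0 : ℝ), ‖f (t, s)‖ =
        (1 / Real.cosh s) ^ (α + 1) * Real.Gamma (α + 1) * Real.cosh (α * s) := by
    intro s
    have hc := Real.cosh_pos s
    have hi : IntegrableOn (fun t : ℝ => t ^ α * Real.exp (-Real.cosh s * t)) (Ioi 0) := by
      simpa using integrableOn_rpow_mul_exp_neg_mul_rpow (p := 1) (s := α) (by linarith)
        one_pos hc
    have heq : (fun t : ℝ => f (t, s)) =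
        fun t : ℝ => t ^ α * Real.exp (-Real.cosh s * t) * Real.cosh (α * s) := by
      funext t
      simp only [f]
      rw [show -t * Real.cosh s = -Real.cosh s * t by ring]
      ring
    refine ⟨by rw [heq]; exact hi.mul_const _, ?_⟩
    rw [← Real.integral_rpow_mul_exp_neg_mul_Ioi (by linarith : 0 < α + 1) hc, ← integral_mul_const]
    refine setIntegral_congr_fun measurableSet_Ioi fun t ht => ?_
    have h1 : 0 ≤ t ^ α := Real.rpow_nonneg (le_of_lt ht) _
    have h2 := Real.cosh_pos (α * s)
    have h3 := congrFun heq t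
    beta_reduce at h3 ⊢
    rw [h3, Real.norm_of_nonneg (by positivity)]
    ring_nf
  have hf : Integrable f (μ.prod μ) := by
    rw [integrable_prod_iff' hfc.aestronglyMeasurable]
    refine ⟨ae_of_all _ fun s => (hslice s).1, ?_⟩
    simp only [μ, (hslice _).2]
    have hb : IntegrableOn (fun s : ℝ => 2 ^ (α + 1) * Real.Gamma (α + 1) * Real.exp (-s))
        (Ioi 0) := (integrableOn_exp_neg_Ioi 0).const_mul _
    refine Integrable.mono' hb ?_ ?_
    · exact Measurable.aestronglyMeasurable (by fun_prop)
    · filter_upwards [ae_restrict_mem measurableSet_Ioi] with s hs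
      have hs' : 0 ≤ s := le_of_lt hs
      have hc := Real.cosh_pos s
      have hc2 := Real.cosh_pos (α * s)
      have hG := Real.Gamma_pos_of_pos (by linarith : 0 < α + 1)
      rw [Real.norm_of_nonneg (by positivity)]
      have h1 : (1 / Real.cosh s) ^ (α + 1) ≤ 2 ^ (α + 1) * Real.exp (-s * (α + 1)) := by
        rw [Real.exp_mul, ← Real.mul_rpow (by norm_num) (Real.exp_pos _).le]
        refine Real.rpow_le_rpow (by positivity) ?_ (by linarith)
        rw [Real.exp_neg, div_le_iff₀ hc]
        have := exp_half_le_cosh s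
        have he := Real.exp_pos s
        field_simp
        linarith
      calc (1 / Real.cosh s) ^ (α + 1) * Real.Gamma (α + 1) * Real.cosh (α * s)
          ≤ 2 ^ (α + 1) * Real.exp (-s * (α + 1)) * Real.Gamma (α + 1) * Real.exp (α * s) := by
            gcongr
            exact cosh_mul_le_exp hα hs'
        _ = 2 ^ (α + 1) * Real.Gamma (α + 1) * Real.exp (-s) := by
            rw [show -s = -s * (α + 1) + α * s by ring, Real.exp_add]
            ring_nf
  have := hf.integral_prod_left
  simp only [f, integral_const_mul] at this
  exact this

end Bessel

section VolumeTerm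

variable {d : ℕ}

lemma Gfun_nonneg (x : EuclideanSpace ℝ (Fin d)) : 0 ≤ Gfun d x := by
  have : 0 ≤ besselK ((d : ℝ) / 2 - 1) ‖x‖ :=
    integral_nonneg fun s => by
      have := Real.cosh_pos (((d : ℝ) / 2 - 1) * s)
      positivity
  unfold Gfun
  positivity

lemma measurable_Gfun : Measurable (Gfun d) := by
  have h := (stronglyMeasurable_besselK ((d : ℝ) / 2 - 1)).measurable
  unfold Gfun
  fun_prop

lemma Ffun_eq (hd : 2 ≤ d) {x : EuclideanSpace ℝ (Fin d)} (hx : x ≠ 0) :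
    Ffun d x = (2 * Real.pi) ^ (-(d : ℝ) / 2) * ‖x‖ ^ (1 - (d : ℝ) / 2)
      * besselK ((d : ℝ) / 2 - 1 - 1) ‖x‖ := by
  have hd' : (2 : ℝ) ≤ d := by exact_mod_cast hd
  rw [← neg_deriv_besselK_sub (by linarith) (norm_pos_iff.2 hx)]
  unfold Ffun Gfun Hfun
  ring

lemma abs_Ffun_le (hd : 3 ≤ d) {x : EuclideanSpace ℝ (Fin d)} (hx : x ≠ 0) :
    |Ffun d x| ≤ Gfun d x := by
  have hd' : (3 : ℝ) ≤ d := by exact_mod_cast hd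
  have hx' := norm_pos_iff.2 hx
  have h1 := (besselK_pos ((d : ℝ) / 2 - 1 - 1) hx').le
  rw [Ffun_eq (by omega) hx, abs_of_nonneg (by positivity)]
  unfold Gfun
  refine mul_le_mul_of_nonneg_left (besselK_mono ?_ hx') (by positivity)
  rw [abs_of_nonneg (by linarith : 0 ≤ (d : ℝ) / 2 - 1), abs_le]
  constructor <;> linarith

lemma integrable_Gfun_div_norm (hd : 2 ≤ d) :
    Integrable (fun u : EuclideanSpace ℝ (Fin d) => Gfun d u / ‖u‖) := by
  have hd' : (2 : ℝ) ≤ d := by exact_mod_cast hd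
  have : Nonempty (Fin d) := ⟨⟨0, by omega⟩⟩
  have h := (integrable_fun_norm_addHaar (volume : Measure (EuclideanSpace ℝ (Fin d)))
    (f := fun r : ℝ => (2 * Real.pi) ^ (-(d : ℝ) / 2) * r ^ (1 - (d : ℝ) / 2)
      * besselK ((d : ℝ) / 2 - 1) r / r)).2 ?_
  · exact h
  · refine IntegrableOn.congr_fun ((integrableOn_rpow_mul_besselK
      (by linarith : 0 ≤ (d : ℝ) / 2 - 1)).const_mul ((2 * Real.pi) ^ (-(d : ℝ) / 2)))
      (fun r hr => ?_) measurableSet_Ioi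
    have hr' : 0 < r := hr
    have hp : r ^ ((d : ℝ) / 2 - 1) = r ^ (d - 1) * r ^ (1 - (d : ℝ) / 2) / r := by
      rw [← Real.rpow_natCast, ← Real.rpow_add hr', ← Real.rpow_sub_one hr'.ne']
      congr 1
      push_cast [Nat.cast_sub (by omega : 1 ≤ d)]
      ring
    simp only [finrank_euclideanSpace, Fintype.card_fin, smul_eq_mul, hp]
    ring

lemma enorm_Fa_div_norm_le (hd : 3 ≤ d) {a : ℝ} (ha : 0 < a) (z : EuclideanSpace ℝ (Fin d)) :
    ‖Fa d a z / ‖z‖‖ₑ ≤ ENNReal.ofReal (a ^ (d + 1)) * ‖Gfun d (a • z) / ‖a • z‖‖ₑ := by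
  rcases eq_or_ne z 0 with rfl | hz
  · simp
  have hz' := norm_pos_iff.2 hz
  have hG := Gfun_nonneg (a • z)
  rw [← Real.enorm_of_nonneg (by positivity : 0 ≤ a ^ (d + 1)), ← enorm_mul]
  refine enorm_le_iff_norm_le.2 ?_
  rw [norm_smul, Real.norm_of_nonneg ha.le,
    Real.norm_of_nonneg (by positivity : 0 ≤ a ^ (d + 1) * (Gfun d (a • z) / (a * ‖z‖)))]
  unfold Fa
  rw [Real.norm_eq_abs, abs_div, abs_mul, Real.rpow_natCast, abs_of_pos (pow_pos ha d),
    abs_of_pos hz']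
  have h := abs_Ffun_le hd (smul_ne_zero ha.ne' hz)
  calc a ^ d * |Ffun d (a • z)| / ‖z‖ ≤ a ^ d * Gfun d (a • z) / ‖z‖ := by gcongr
    _ = a ^ (d + 1) * (Gfun d (a • z) / (a * ‖z‖)) := by
      field_simp
      ring

lemma lintegral_comp_smul_euclidean {f : EuclideanSpace ℝ (Fin d) → ℝ≥0∞} (hf : Measurable f)
    {a : ℝ} (ha : 0 < a) :
    ∫⁻ x, f (a • x) = ENNReal.ofReal ((a ^ d)⁻¹) * ∫⁻ x, f x := by
  have h := Measure.map_addHaar_smul (volume : Measure (EuclideanSpace ℝ (Fin d))) ha.ne'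
  rw [← lintegral_map hf (measurable_const_smul a), h, lintegral_smul_measure,
    finrank_euclideanSpace, Fintype.card_fin, abs_of_pos (by positivity), smul_eq_mul]

lemma enorm_volumeTerm_le (hd : 3 ≤ d) (Ω : Set (EuclideanSpace ℝ (Fin d))) {a : ℝ} (ha : 0 < a) :
    ‖∫ x in Ωᶜ, ∫ y in Ω, Fa d a (x - y) / ‖x - y‖‖ₑ
      ≤ ENNReal.ofReal a * (volume Ω * ∫⁻ u, ‖Gfun d u / ‖u‖‖ₑ) := by
  have hg : Measurable (fun u : EuclideanSpace ℝ (Fin d) => ‖Gfun d u / ‖u‖‖ₑ) :=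
    (measurable_Gfun.div measurable_norm).enorm
  set g : EuclideanSpace ℝ (Fin d) → ℝ≥0∞ := fun z =>
    ENNReal.ofReal (a ^ (d + 1)) * ‖Gfun d (a • z) / ‖a • z‖‖ₑ with hgdef
  have hgm : Measurable g := (hg.comp (measurable_const_smul a)).const_mul _
  have hgi : ∫⁻ z, g z = ENNReal.ofReal a * ∫⁻ u, ‖Gfun d u / ‖u‖‖ₑ := by
    have hga : Measurable (fun z : EuclideanSpace ℝ (Fin d) => ‖Gfun d (a • z) / ‖a • z‖‖ₑ) :=
      hg.comp (measurable_const_smul a)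
    rw [hgdef, lintegral_const_mul _ hga, lintegral_comp_smul_euclidean hg ha, ← mul_assoc, ← ENNReal.ofReal_mul (by positivity)]
    congr 2
    field_simp
    ring
  calc ‖∫ x in Ωᶜ, ∫ y in Ω, Fa d a (x - y) / ‖x - y‖‖ₑ
      ≤ ∫⁻ x in Ωᶜ, ‖∫ y in Ω, Fa d a (x - y) / ‖x - y‖‖ₑ := enorm_integral_le_lintegral_enorm _
    _ ≤ ∫⁻ x, ‖∫ y in Ω, Fa d a (x - y) / ‖x - y‖‖ₑ := setLIntegral_le_lintegral _ _
    _ ≤ ∫⁻ x, ∫⁻ y in Ω, g (x - y) := by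
      refine lintegral_mono fun x => (enorm_integral_le_lintegral_enorm _).trans ?_
      exact lintegral_mono fun y => enorm_Fa_div_norm_le hd ha _
    _ = ∫⁻ y in Ω, ∫⁻ x, g (x - y) := by
      refine lintegral_lintegral_swap ?_
      exact (hgm.comp (measurable_fst.sub measurable_snd)).aemeasurable
    _ = ∫⁻ _ in Ω, ∫⁻ z, g z := by
      simp only [lintegral_sub_right_eq_self]
    _ = ENNReal.ofReal a * (volume Ω * ∫⁻ u, ‖Gfun d u / ‖u‖‖ₑ) := by
      rw [setLIntegral_const, hgi]
      ring

lemma tendsto_volumeTerm (hd : 3 ≤ d) {Ω : Set (EuclideanSpace ℝ (Fin d))}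
    (hΩ : Bornology.IsBounded Ω) :
    Tendsto (fun a : ℝ => ∫ x in Ωᶜ, ∫ y in Ω, Fa d a (x - y) / ‖x - y‖) (𝓝[>] 0) (𝓝 0) := by
  set C : ℝ≥0∞ := volume Ω * ∫⁻ u : EuclideanSpace ℝ (Fin d), ‖Gfun d u / ‖u‖‖ₑ
  have hC : C ≠ ∞ :=
    ENNReal.mul_ne_top hΩ.measure_lt_top.ne (integrable_Gfun_div_norm (by omega)).2.ne
  have h0 : Tendsto (fun a : ℝ => a * C.toReal) (𝓝[>] 0) (𝓝 0) := by
    have : Tendsto (fun a : ℝ => a * C.toReal) (𝓝 0) (𝓝 (0 * C.toReal)) :=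
      tendsto_id.mul_const _
    rw [zero_mul] at this
    exact this.mono_left nhdsWithin_le_nhds
  refine squeeze_zero_norm' ?_ h0
  filter_upwards [self_mem_nhdsWithin] with a ha
  have h := ENNReal.toReal_mono (ENNReal.mul_ne_top ENNReal.ofReal_ne_top hC)
    (enorm_volumeTerm_le hd Ω ha)
  rwa [toReal_enorm, ENNReal.toReal_mul, ENNReal.toReal_ofReal (le_of_lt ha)] at h

end VolumeTerm

section HausdorffMeasure

/-- A set admitting an antilipschitz map to `ι → ℝ` with bounded image has finite Hausdorff
measure of dimension `card ι`. -/
lemma hausdorffMeasure_lt_top_of_antilipschitz {E : Type*} [MetricSpace E] [MeasurableSpace E]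
    [BorelSpace E] {ι : Type*} [Fintype ι] {π : E → ι → ℝ} {s : Set E} {K : NNReal}
    (hK : ∀ y ∈ s, ∀ z ∈ s, dist y z ≤ K * dist (π y) (π z))
    (hb : Bornology.IsBounded (π '' s)) : μH[(Fintype.card ι : ℝ)] s < ∞ := by
  rcases s.eq_empty_or_nonempty with rfl | ⟨y₀, hy₀⟩
  · simp
  have : Nonempty E := ⟨y₀⟩
  set g := Function.invFunOn π s
  have hg : ∀ v ∈ π '' s, g v ∈ s ∧ π (g v) = v := fun v hv =>
    ⟨Function.invFunOn_mem hv, Function.invFunOn_eq hv⟩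
  have hL : LipschitzOnWith K g (π '' s) := by
    refine LipschitzOnWith.of_dist_le_mul fun v hv w hw => ?_
    have := hK _ (hg v hv).1 _ (hg w hw).1
    rwa [(hg v hv).2, (hg w hw).2] at this
  have hs : s ⊆ g '' (π '' s) := by
    intro y hy
    refine ⟨π y, mem_image_of_mem π hy, ?_⟩
    have h := hg (π y) (mem_image_of_mem π hy)
    have h2 := hK _ h.1 _ hy
    rw [h.2, dist_self, mul_zero] at h2
    exact dist_le_zero.1 h2
  refine (measure_mono hs).trans_lt
    ((hL.hausdorffMeasure_image_le (Nat.cast_nonneg _)).trans_lt ?_)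
  rw [hausdorffMeasure_pi_real]
  exact ENNReal.mul_lt_top (ENNReal.rpow_lt_top_of_nonneg (Nat.cast_nonneg _) ENNReal.coe_ne_top)
    hb.measure_lt_top

variable {d : ℕ}

/-- The zero set of a strictly differentiable function with nonzero differential has locally
finite Hausdorff measure of codimension one. -/
lemma exists_nhds_hausdorffMeasure_zeroSet_lt_top {f : EuclideanSpace ℝ (Fin d) → ℝ}
    {D : EuclideanSpace ℝ (Fin d) →L[ℝ] ℝ} {x : EuclideanSpace ℝ (Fin d)}
    (hf : HasStrictFDerivAt f D x) (hD : D ≠ 0) :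
    ∃ V ∈ 𝓝 x, μH[(d : ℝ) - 1] (V ∩ {y | f y = 0}) < ∞ := by
  obtain ⟨i, hi⟩ : ∃ i, D (EuclideanSpace.single i 1) ≠ 0 := by
    by_contra! h
    refine hD (ContinuousLinearMap.coe_injective ?_)
    refine (EuclideanSpace.basisFun (Fin d) ℝ).toBasis.ext fun i => ?_
    simpa using h i
  let π : EuclideanSpace ℝ (Fin d) →ₗ[ℝ] ({j : Fin d // j ≠ i} → ℝ) :=
    { toFun := fun v j => v j
      map_add' := fun _ _ => rfl
      map_smul' := fun _ _ => rfl }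
  have hker : LinearMap.ker (π.prod (D : EuclideanSpace ℝ (Fin d) →ₗ[ℝ] ℝ)) = ⊥ := by
    rw [LinearMap.ker_eq_bot']
    intro v hv
    obtain ⟨h1, h2⟩ := Prod.ext_iff.1 hv
    have hv' : v = v i • EuclideanSpace.single i 1 := by
      ext j
      by_cases hj : j = i
      · subst hj; simp
      · have : v j = 0 := congrFun h1 ⟨j, hj⟩
        simpa [hj] using this
    have h3 : D v = 0 := h2
    rw [hv', map_smul, smul_eq_mul, mul_eq_zero, or_iff_left hi] at h3
    rw [hv', h3, zero_smul]
  obtain ⟨K, hK0, hK⟩ := LinearMap.exists_antilipschitzWith _ hker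
  have hK0' : (0 : ℝ) < K := hK0
  have hc := hf.isLittleO.def (by positivity : 0 < 1 / (2 * (K : ℝ)))
  obtain ⟨ε, hε, hball⟩ := Metric.mem_nhds_iff.1 hc
  refine ⟨Metric.ball x ε, Metric.ball_mem_nhds x hε, ?_⟩
  have hcard : (Fintype.card {j : Fin d // j ≠ i} : ℝ) = (d : ℝ) - 1 := by
    have := i.pos
    rw [Fintype.card_subtype_compl, Fintype.card_fin, Fintype.card_unique,
      Nat.cast_sub (by omega), Nat.cast_one]
  rw [← hcard]
  have hπ : Continuous π := LinearMap.continuous_of_finiteDimensional π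
  refine hausdorffMeasure_lt_top_of_antilipschitz (π := π) (K := K) ?_ ?_
  · rintro y ⟨hy, hfy⟩ z ⟨hz, hfz⟩
    have hmem : (y, z) ∈ Metric.ball (x, x) ε := by
      rw [← ball_prod_same]
      exact ⟨hy, hz⟩
    have h1 : ‖f y - f z - D (y - z)‖ ≤ 1 / (2 * (K : ℝ)) * ‖y - z‖ := hball hmem
    rw [show f y = 0 from hfy, show f z = 0 from hfz, sub_zero, zero_sub, norm_neg,
      map_sub, ← dist_eq_norm, ← dist_eq_norm] at h1
    have h2 : dist y z ≤ K * max (dist (π y) (π z)) (dist (D y) (D z)) := hK.le_mul_dist y z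
    rcases le_total (dist (D y) (D z)) (dist (π y) (π z)) with h | h
    · rwa [max_eq_left h] at h2
    · rw [max_eq_right h] at h2
      have h3 : (K : ℝ) * dist (D y) (D z) ≤ dist y z / 2 := by
        calc (K : ℝ) * dist (D y) (D z) ≤ K * (1 / (2 * (K : ℝ)) * dist y z) := by gcongr
          _ = dist y z / 2 := by field_simp
      have h4 : dist y z ≤ 0 := by linarith
      exact h4.trans (by positivity)
  · have hb : Bornology.IsBounded (π '' Metric.closedBall x ε) :=
      ((isCompact_closedBall x ε).image hπ).isBounded
    exact hb.subset (image_mono (inter_subset_left.trans Metric.ball_subset_closedBall))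

lemma IsBoundedC2Domain.isCompact_frontier {Ω : Set (EuclideanSpace ℝ (Fin d))}
    (hΩ : IsBoundedC2Domain Ω) : IsCompact (frontier Ω) :=
  Metric.isCompact_of_isClosed_isBounded isClosed_frontier
    (hΩ.2.2.1.closure.subset frontier_subset_closure)

lemma IsBoundedC2Domain.hausdorffMeasure_frontier_lt_top {Ω : Set (EuclideanSpace ℝ (Fin d))}
    (hΩ : IsBoundedC2Domain Ω) : μH[(d : ℝ) - 1] (frontier Ω) < ∞ := by
  refine hΩ.isCompact_frontier.measure_lt_top_of_nhdsWithin fun x hx => ?_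
  obtain ⟨U, f, hU, hxU, hf, hD, -, hfr⟩ := hΩ.2.2.2 x hx
  obtain ⟨V, hV, hlt⟩ := exists_nhds_hausdorffMeasure_zeroSet_lt_top
    (hf.contDiffAt.hasStrictFDerivAt (x := x) (by norm_num)) (hD x hxU)
  refine ⟨frontier Ω ∩ (U ∩ V), inter_mem_nhdsWithin _
    (inter_mem (hU.mem_nhds hxU) hV), (measure_mono ?_).trans_lt hlt⟩
  rintro y ⟨hy, hyU, hyV⟩
  have : y ∈ {y ∈ U | f y = 0} := hfr ▸ ⟨hy, hyU⟩
  exact ⟨hyV, this.2⟩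

end HausdorffMeasure

section Weight

variable {d : ℕ}

lemma Wfun_integrableOn (hd : 2 ≤ d) : IntegrableOn
    (fun t : ℝ => t ^ ((d : ℝ) / 2 - 1) * besselK ((d : ℝ) / 2 - 1) t) (Ioi 0) := by
  have hd' : (2 : ℝ) ≤ d := by exact_mod_cast hd
  exact integrableOn_rpow_mul_besselK (by linarith)

lemma rpow_mul_besselK_pos (α : ℝ) {t : ℝ} (ht : 0 < t) : 0 < t ^ α * besselK α t :=
  mul_pos (Real.rpow_pos_of_pos ht _) (besselK_pos α ht)

/-- The tail integrals defining `W` decrease with the radius. -/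
lemma setIntegral_Ioi_besselK_anti (hd : 2 ≤ d) {r s : ℝ} (hr : 0 ≤ r) (hrs : r ≤ s) :
    ∫ t in Ioi s, t ^ ((d : ℝ) / 2 - 1) * besselK ((d : ℝ) / 2 - 1) t
      ≤ ∫ t in Ioi r, t ^ ((d : ℝ) / 2 - 1) * besselK ((d : ℝ) / 2 - 1) t := by
  refine setIntegral_mono_set ((Wfun_integrableOn hd).mono_set (Ioi_subset_Ioi hr)) ?_
    (Ioi_subset_Ioi hrs).eventuallyLE
  filter_upwards [ae_restrict_mem measurableSet_Ioi] with t ht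
  exact (rpow_mul_besselK_pos _ (hr.trans_lt ht)).le

lemma setIntegral_Ioi_besselK_pos (hd : 2 ≤ d) {r : ℝ} (hr : 0 ≤ r) :
    0 < ∫ t in Ioi r, t ^ ((d : ℝ) / 2 - 1) * besselK ((d : ℝ) / 2 - 1) t := by
  rw [setIntegral_pos_iff_support_of_nonneg_ae]
  · have : Ioi r ⊆ Function.support
        (fun t : ℝ => t ^ ((d : ℝ) / 2 - 1) * besselK ((d : ℝ) / 2 - 1) t) :=
      fun t ht => (rpow_mul_besselK_pos _ (hr.trans_lt ht)).ne'
    rw [inter_eq_right.2 this, Real.volume_Ioi]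
    exact ENNReal.zero_lt_top
  · filter_upwards [ae_restrict_mem measurableSet_Ioi] with t ht
    exact (rpow_mul_besselK_pos _ (hr.trans_lt ht)).le
  · exact (Wfun_integrableOn hd).mono_set (Ioi_subset_Ioi hr)

lemma Wfun_pos (hd : 2 ≤ d) (x : EuclideanSpace ℝ (Fin d)) : 0 < Wfun d x :=
  mul_pos (by positivity) (setIntegral_Ioi_besselK_pos hd (norm_nonneg x))

lemma Wfun_le_kappa (hd : 2 ≤ d) (x : EuclideanSpace ℝ (Fin d)) : Wfun d x ≤ kappa d :=
  mul_le_mul_of_nonneg_left (setIntegral_Ioi_besselK_anti hd le_rfl (norm_nonneg x))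
    (by positivity)

lemma Wfun_anti (hd : 2 ≤ d) {x y : EuclideanSpace ℝ (Fin d)} (h : ‖x‖ ≤ ‖y‖) :
    Wfun d y ≤ Wfun d x :=
  mul_le_mul_of_nonneg_left (setIntegral_Ioi_besselK_anti hd (norm_nonneg x) h) (by positivity)

lemma measurable_Wfun (hd : 2 ≤ d) : Measurable (Wfun d) := by
  have h : Antitone fun r : ℝ => ∫ t in Ioi (max r 0),
      t ^ ((d : ℝ) / 2 - 1) * besselK ((d : ℝ) / 2 - 1) t := fun r s hrs =>
    setIntegral_Ioi_besselK_anti hd (le_max_right _ _) (max_le_max_right 0 hrs)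
  have h2 := (h.measurable.comp
    (measurable_norm (α := EuclideanSpace ℝ (Fin d)))).const_mul ((2 * Real.pi) ^ (-(d : ℝ) / 2))
  convert h2 using 2 with x
  simp [Wfun]

lemma measurable_Wa (hd : 2 ≤ d) (a : ℝ) : Measurable (Wa d a) :=
  (measurable_Wfun hd).comp (measurable_const_smul a)

lemma tendsto_Wa (hd : 2 ≤ d) (x : EuclideanSpace ℝ (Fin d)) :
    Tendsto (fun a => Wa d a x) (𝓝[>] 0) (𝓝 (kappa d)) := by
  unfold Wa Wfun kappa
  refine Tendsto.const_mul _ ?_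
  set w : ℝ → ℝ := fun t => t ^ ((d : ℝ) / 2 - 1) * besselK ((d : ℝ) / 2 - 1) t
  have hw : IntegrableOn w (Ioi 0) := Wfun_integrableOn hd
  have heq : ∀ a : ℝ, ∫ t in Ioi ‖a • x‖, w t = ∫ t in Ioi (0 : ℝ), (Ioi ‖a • x‖).indicator w t := by
    intro a
    rw [setIntegral_indicator measurableSet_Ioi,
      inter_eq_right.2 (Ioi_subset_Ioi (norm_nonneg _))]
  simp only [heq]
  refine tendsto_integral_filter_of_dominated_convergence (fun t => ‖w t‖) ?_ ?_ hw.norm ?_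
  · exact Eventually.of_forall fun a => hw.1.indicator measurableSet_Ioi
  · exact Eventually.of_forall fun a => ae_of_all _ fun t => norm_indicator_le_norm_self _ _
  · filter_upwards [ae_restrict_mem measurableSet_Ioi] with t ht
    refine tendsto_const_nhds.congr' ?_
    have h0 : Tendsto (fun a : ℝ => ‖a • x‖) (𝓝[>] 0) (𝓝 0) := by
      have : Continuous fun a : ℝ => ‖a • x‖ := by fun_prop
      simpa using (this.tendsto 0).mono_left nhdsWithin_le_nhds
    filter_upwards [h0.eventually_lt_const ht] with a ha
    rw [indicator_of_mem (show t ∈ Ioi ‖a • x‖ from ha)]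

end Weight

section WeightedEnergy

variable {X : Type*} [MeasurableSpace X]

lemma integrable_mul_iff_of_bounds {μ : Measure X} {h ω : X → ℝ} (hω : Measurable ω) {c C : ℝ}
    (hc : 0 < c) (hcω : ∀ᵐ y ∂μ, c ≤ ω y) (hωC : ∀ᵐ y ∂μ, ω y ≤ C) :
    Integrable (fun y => ω y * h y) μ ↔ Integrable h μ := by
  constructor
  · intro hi
    have hi' : Integrable (fun y => (max c (ω y))⁻¹ * (ω y * h y)) μ := by
      refine hi.bdd_mul (c := c⁻¹) (by fun_prop) (ae_of_all _ fun y => ?_)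
      have h1 : c ≤ max c (ω y) := le_max_left _ _
      rw [norm_inv, Real.norm_of_nonneg (hc.le.trans h1)]
      gcongr
    refine hi'.congr ?_
    filter_upwards [hcω] with y hy
    have : ω y ≠ 0 := (hc.trans_le hy).ne'
    rw [max_eq_right hy]
    field_simp
  · intro hi
    refine hi.bdd_mul (c := C) hω.aestronglyMeasurable ?_
    filter_upwards [hcω, hωC] with y h1 h2
    rwa [Real.norm_of_nonneg (hc.le.trans h1)]

/-- Comparison of a weighted integral with the unweighted one, valid also when neither integrand
is integrable. -/
lemma integral_mul_bounds {μ : Measure X} {h ω : X → ℝ} (hω : Measurable ω) (h0 : ∀ y, 0 ≤ h y)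
    {c C : ℝ} (hc : 0 < c) (hcω : ∀ᵐ y ∂μ, c ≤ ω y) (hωC : ∀ᵐ y ∂μ, ω y ≤ C) :
    c * ∫ y, h y ∂μ ≤ ∫ y, ω y * h y ∂μ ∧ ∫ y, ω y * h y ∂μ ≤ C * ∫ y, h y ∂μ := by
  have hiff := integrable_mul_iff_of_bounds (h := h) hω hc hcω hωC
  by_cases hi : Integrable h μ
  · rw [← integral_const_mul, ← integral_const_mul]
    constructor
    · refine integral_mono_ae (hi.const_mul c) (hiff.2 hi) ?_
      filter_upwards [hcω] with y hy
      exact mul_le_mul_of_nonneg_right hy (h0 y)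
    · refine integral_mono_ae (hiff.2 hi) (hi.const_mul C) ?_
      filter_upwards [hωC] with y hy
      exact mul_le_mul_of_nonneg_right hy (h0 y)
  · rw [integral_undef hi, integral_undef (mt hiff.1 hi)]
    simp

lemma aestronglyMeasurable_of_eq_zero_iff {μ : Measure X} {f g Ψ : X → ℝ} {N : Set X}
    (hf : AEStronglyMeasurable f μ) (hΨ : StronglyMeasurable Ψ) (hg : g =ᵐ[μ] N.indicator Ψ)
    (hfg : ∀ᵐ x ∂μ, f x = 0 ↔ g x = 0) : AEStronglyMeasurable g μ := by
  have hT : NullMeasurableSet (f ⁻¹' {0}ᶜ) μ :=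
    hf.aemeasurable.nullMeasurable (measurableSet_singleton 0).compl
  refine (hΨ.aestronglyMeasurable.indicator₀ hT).congr ?_
  filter_upwards [hg, hfg] with x h1 h2
  by_cases hx : f x = 0
  · rw [indicator_of_notMem (by simpa using hx), h2.1 hx]
  · rw [indicator_of_mem (by simpa using hx)]
    by_cases hN : x ∈ N
    · rw [h1, indicator_of_mem hN]
    · rw [indicator_of_notMem hN] at h1
      exact absurd (h2.2 h1) hx

variable {E : Type*} [NormedAddCommGroup E] [InnerProductSpace ℝ E]

/-- The vectors whose inner product with the (possibly non-measurable) field `ν` is almost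
everywhere measurable. -/
def measurableDirections (μ : Measure X) (ν : X → E) : Submodule ℝ E where
  carrier := {v | AEStronglyMeasurable (fun y => ⟪v, ν y⟫) μ}
  zero_mem' := by
    simpa using (aestronglyMeasurable_const : AEStronglyMeasurable (fun _ : X => (0 : ℝ)) μ)
  add_mem' := fun {v w} hv hw =>
    (AEStronglyMeasurable.add hv hw).congr (ae_of_all _ fun y => (inner_add_left v w (ν y)).symm)
  smul_mem' := fun c v hv =>
    (AEStronglyMeasurable.const_mul hv c).congr
      (ae_of_all _ fun y => (real_inner_smul_left v (ν y) c).symm)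

lemma mem_measurableDirections {μ : Measure X} {ν : X → E} {v : E} :
    v ∈ measurableDirections μ ν ↔ AEStronglyMeasurable (fun y => ⟪v, ν y⟫) μ := Iff.rfl

variable [FiniteDimensional ℝ E]

lemma aestronglyMeasurable_starProjection_measurableDirections (μ : Measure X) (ν : X → E) :
    AEStronglyMeasurable (fun y => (measurableDirections μ ν).starProjection (ν y)) μ := by
  let b := stdOrthonormalBasis ℝ (measurableDirections μ ν)
  have h : (fun y => (measurableDirections μ ν).starProjection (ν y)) =
      fun y => ∑ i, ⟪(b i : E), ν y⟫ • (b i : E) := by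
    funext y
    simp [b.starProjection_eq_sum_rankOne]
  rw [h]
  refine Finset.aestronglyMeasurable_fun_sum _ fun i _ => ?_
  exact (mem_measurableDirections.1 (b i).2).smul_const _

/-- For a unit field `ν`, without any measurability assumption, the inner integral of a weighted
`‖ν x - ν y‖ ^ 2` agrees almost everywhere with a measurable function cut off to a set which does
not depend on the weight. -/
lemma exists_indicator_representation {μ : Measure X} [SFinite μ] {ν : X → E}
    (hν : ∀ᵐ x ∂μ, ‖ν x‖ = 1) :
    ∃ N : Set X, ∀ p : X × X → ℝ, Measurable p → (∀ x, ∀ᵐ y ∂μ, p (x, y) ≠ 0) →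
      ∃ Ψ : X → ℝ, StronglyMeasurable Ψ ∧
        (fun x => ∫ y, p (x, y) * ‖ν x - ν y‖ ^ 2 ∂μ) =ᵐ[μ] N.indicator Ψ := by
  have hu := aestronglyMeasurable_starProjection_measurableDirections μ ν
  set V := measurableDirections μ ν
  refine ⟨{x | ν x ∈ V}, fun p hp hp0 => ?_⟩
  obtain ⟨u, hum, hue⟩ := hu
  refine ⟨fun x => ∫ y, p (x, y) * (2 - 2 * ⟪u x, u y⟫) ∂μ, ?_, ?_⟩
  · have hf : StronglyMeasurable fun z : X × X => p z * (2 - 2 * ⟪u z.1, u z.2⟫) :=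
      hp.stronglyMeasurable.mul (stronglyMeasurable_const.sub (((hum.comp_measurable
        measurable_fst).inner (hum.comp_measurable measurable_snd)).const_mul 2))
    exact hf.integral_prod_right'
  · filter_upwards [hν, hue] with x hx1 hxu
    have hexp : ∀ y, ‖ν y‖ = 1 → ‖ν x - ν y‖ ^ 2 = 2 - 2 * ⟪ν x, ν y⟫ := by
      intro y hy
      rw [norm_sub_sq_real, hx1, hy]
      ring
    by_cases hxV : ν x ∈ V
    · rw [indicator_of_mem (show x ∈ {x | ν x ∈ V} from hxV)]
      refine integral_congr_ae ?_
      filter_upwards [hν, hue] with y hy1 hyu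
      rw [hexp y hy1, ← hxu, ← hyu, V.starProjection_eq_self_iff.2 hxV,
        ← V.inner_starProjection_left_eq_right, V.starProjection_eq_self_iff.2 hxV]
    · rw [indicator_of_notMem (show x ∉ {x | ν x ∈ V} from hxV)]
      refine integral_undef fun hi => hxV ?_
      have h1 : AEStronglyMeasurable
          (fun y => 1 - (p (x, y))⁻¹ * (p (x, y) * ‖ν x - ν y‖ ^ 2) / 2) μ := by
        have hpx : Measurable fun y => (p (x, y))⁻¹ := (hp.comp measurable_prodMk_left).inv
        exact aestronglyMeasurable_const.sub
          ((hpx.aestronglyMeasurable.mul hi.1).div₀ aestronglyMeasurable_const)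
      refine h1.congr ?_
      filter_upwards [hν, hp0 x] with y hy1 hy0
      rw [inv_mul_cancel_left₀ hy0, hexp y hy1]
      ring

lemma tendsto_weighted_energy {μ : Measure X} [SFinite μ] {ν : X → E}
    (hν : ∀ᵐ x ∂μ, ‖ν x‖ = 1) {q : X × X → ℝ} (hq : Measurable q) (hq0 : ∀ z, 0 ≤ q z)
    (hqne : ∀ x, ∀ᵐ y ∂μ, q (x, y) ≠ 0) {ω : ℝ → X × X → ℝ} (hω : ∀ a, Measurable (ω a))
    {C : ℝ} (hωC : ∀ a z, ω a z ≤ C) {S : Set X} (hS : ∀ᵐ x ∂μ, x ∈ S)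
    (hωc : ∀ a > 0, ∃ c > 0, ∀ x ∈ S, ∀ y ∈ S, c ≤ ω a (x, y))
    (hlim : ∀ z, Tendsto (fun a => ω a z) (𝓝[>] 0) (𝓝 C)) :
    Tendsto (fun a => ∫ x, ∫ y, ω a (x, y) * (q (x, y) * ‖ν x - ν y‖ ^ 2) ∂μ ∂μ) (𝓝[>] 0)
      (𝓝 (C * ∫ x, ∫ y, q (x, y) * ‖ν x - ν y‖ ^ 2 ∂μ ∂μ)) := by
  set J₀ : X → ℝ := fun x => ∫ y, q (x, y) * ‖ν x - ν y‖ ^ 2 ∂μ with hJ₀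
  set J : ℝ → X → ℝ := fun a x => ∫ y, ω a (x, y) * (q (x, y) * ‖ν x - ν y‖ ^ 2) ∂μ with hJ
  have hk0 : ∀ x y, 0 ≤ q (x, y) * ‖ν x - ν y‖ ^ 2 := fun x y =>
    mul_nonneg (hq0 _) (sq_nonneg _)
  have hJ₀0 : ∀ x, 0 ≤ J₀ x := fun x => integral_nonneg fun y => hk0 x y
  have hωx : ∀ a x, Measurable fun y => ω a (x, y) := fun a x => (hω a).comp measurable_prodMk_left
  have hbd : ∀ a > 0, ∃ c > 0, ∀ x ∈ S, c * J₀ x ≤ J a x ∧ J a x ≤ C * J₀ x := by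
    intro a ha
    obtain ⟨c, hc, hcω⟩ := hωc a ha
    refine ⟨c, hc, fun x hx => integral_mul_bounds (hωx a x) (hk0 x) hc ?_
      (ae_of_all _ fun y => hωC a _)⟩
    filter_upwards [hS] with y hy using hcω x hx y hy
  have hzero : ∀ a > 0, ∀ᵐ x ∂μ, J₀ x = 0 ↔ J a x = 0 := by
    intro a ha
    obtain ⟨c, hc, hcJ⟩ := hbd a ha
    filter_upwards [hS] with x hx
    obtain ⟨h1, h2⟩ := hcJ x hx
    constructor
    · intro h
      rw [h, mul_zero] at h1 h2
      exact le_antisymm h2 h1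
    · intro h
      rw [h] at h1
      exact le_antisymm (nonpos_of_mul_nonpos_right h1 hc) (hJ₀0 x)
  obtain ⟨N, hN⟩ := exists_indicator_representation hν
  have hmeas : ∀ a > 0, AEStronglyMeasurable J₀ μ ↔ AEStronglyMeasurable (J a) μ := by
    intro a ha
    obtain ⟨c, hc, hcω⟩ := hωc a ha
    constructor
    · intro h
      obtain ⟨Ψ, hΨ, hΨe⟩ := hN (fun z => max c (ω a z) * q z)
        ((measurable_const.max (hω a)).mul hq) (fun x => by
          filter_upwards [hqne x] with y hy
          exact mul_ne_zero (hc.trans_le (le_max_left _ _)).ne' hy)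
      refine aestronglyMeasurable_of_eq_zero_iff (N := N) h hΨ ?_ (hzero a ha)
      refine EventuallyEq.trans ?_ hΨe
      filter_upwards [hS] with x hx
      refine integral_congr_ae ?_
      filter_upwards [hS] with y hy
      rw [max_eq_right (hcω x hx y hy), mul_assoc]
    · intro h
      obtain ⟨Ψ, hΨ, hΨe⟩ := hN q hq hqne
      exact aestronglyMeasurable_of_eq_zero_iff h hΨ hΨe
        ((hzero a ha).mono fun x hx => hx.symm)
  by_cases hint : Integrable J₀ μ
  · rw [← integral_const_mul]
    refine tendsto_integral_filter_of_dominated_convergence (fun x => C * J₀ x) ?_ ?_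
      (hint.const_mul C) ?_
    · filter_upwards [self_mem_nhdsWithin] with a ha using (hmeas a ha).1 hint.1
    · filter_upwards [self_mem_nhdsWithin] with a ha
      obtain ⟨c, hc, hcJ⟩ := hbd a ha
      filter_upwards [hS] with x hx
      obtain ⟨h1, h2⟩ := hcJ x hx
      rwa [Real.norm_of_nonneg ((mul_nonneg hc.le (hJ₀0 x)).trans h1)]
    · filter_upwards [hS] with x hx
      by_cases hi : Integrable (fun y => q (x, y) * ‖ν x - ν y‖ ^ 2) μ
      · rw [← integral_const_mul]
        refine tendsto_integral_filter_of_dominated_convergence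
          (fun y => C * (q (x, y) * ‖ν x - ν y‖ ^ 2)) ?_ ?_ (hi.const_mul C) ?_
        · exact Eventually.of_forall fun a => (hωx a x).aestronglyMeasurable.mul hi.1
        · filter_upwards [self_mem_nhdsWithin] with a ha
          obtain ⟨c, hc, hcω⟩ := hωc a ha
          filter_upwards [hS] with y hy
          rw [Real.norm_of_nonneg (mul_nonneg (hc.le.trans (hcω x hx y hy)) (hk0 x y))]
          exact mul_le_mul_of_nonneg_right (hωC a _) (hk0 x y)
        · exact ae_of_all _ fun y => (hlim (x, y)).mul_const _
      · have h0 : J₀ x = 0 := integral_undef hi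
        change Tendsto (fun a => J a x) _ (𝓝 (C * J₀ x))
        rw [h0, mul_zero]
        refine tendsto_const_nhds.congr' ?_
        filter_upwards [self_mem_nhdsWithin] with a ha
        obtain ⟨c, hc, hcJ⟩ := hbd a ha
        obtain ⟨h1, h2⟩ := hcJ x hx
        rw [h0, mul_zero] at h1 h2
        exact le_antisymm h1 h2
  · rw [integral_undef hint, mul_zero]
    refine tendsto_const_nhds.congr' ?_
    filter_upwards [self_mem_nhdsWithin] with a ha
    refine (integral_undef fun hi => hint ?_).symm
    obtain ⟨c, hc, hcJ⟩ := hbd a ha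
    refine (hi.const_mul c⁻¹).mono' ((hmeas a ha).2 hi.1) ?_
    filter_upwards [hS] with x hx
    rw [Real.norm_of_nonneg (hJ₀0 x), le_inv_mul_iff₀ hc]
    exact (hcJ x hx).1

end WeightedEnergy

/-- **Theorem 1.2, (8).** For `d ≥ 3` and a bounded `C²` domain `Ω ⊂ ℝ^d`,
`lim_{a → 0⁺} Φ(Ω,a) = κ ∫_{∂Ω}∫_{∂Ω} |ν(x)-ν(y)|²/|x-y|^{d-1} dσ dσ`. -/
theorem Phi_tendsto_zero (d : ℕ) (hd : 3 ≤ d)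
    (Ω : Set (EuclideanSpace ℝ (Fin d))) (hΩ : IsBoundedC2Domain Ω)
    (ν : EuclideanSpace ℝ (Fin d) → EuclideanSpace ℝ (Fin d))
    (hν : IsOutwardUnitNormal Ω ν) :
    Tendsto (Phi d Ω ν) (nhdsWithin 0 (Set.Ioi 0)) (nhds (kappa d * nuSqInt d Ω ν)) := by
  have hd2 : 2 ≤ d := by omega
  have hd' : (3 : ℝ) ≤ d := by exact_mod_cast hd
  set σ : Measure (EuclideanSpace ℝ (Fin d)) := μH[(d : ℝ) - 1].restrict (frontier Ω) with hσ
  have hfin : IsFiniteMeasure σ :=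
    ⟨by rw [hσ, Measure.restrict_apply_univ]; exact hΩ.hausdorffMeasure_frontier_lt_top⟩
  have hmem : ∀ᵐ x ∂σ, x ∈ frontier Ω := ae_restrict_mem isClosed_frontier.measurableSet
  obtain ⟨R, hR⟩ := hΩ.isCompact_frontier.isBounded.exists_norm_le
  have hboundary : Tendsto (fun a => ∫ x, ∫ y, Wa d a (x - y)
      * ((‖x - y‖ ^ ((d : ℝ) - 1))⁻¹ * ‖ν x - ν y‖ ^ 2) ∂σ ∂σ) (𝓝[>] 0)
      (𝓝 (kappa d * ∫ x, ∫ y, (‖x - y‖ ^ ((d : ℝ) - 1))⁻¹ * ‖ν x - ν y‖ ^ 2 ∂σ ∂σ)) := by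
    refine tendsto_weighted_energy (μ := σ) (q := fun z => (‖z.1 - z.2‖ ^ ((d : ℝ) - 1))⁻¹)
      (ω := fun a z => Wa d a (z.1 - z.2)) (S := frontier Ω)
      (hmem.mono fun x hx => (hν x hx).1) (by fun_prop) (fun z => by positivity) (fun x => ?_)
      (fun a => (measurable_Wa hd2 a).comp (measurable_fst.sub measurable_snd))
      (fun a z => Wfun_le_kappa hd2 _) hmem (fun a ha => ?_) (fun z => tendsto_Wa hd2 _)
    · have hx : σ {x} = 0 := by
        have := Measure.nullSingletonClass_hausdorff (EuclideanSpace ℝ (Fin d))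
          (by linarith : 0 < (d : ℝ) - 1)
        exact measure_singleton x
      filter_upwards [compl_mem_ae_iff.2 hx] with y hy
      have : 0 < ‖x - y‖ := norm_pos_iff.2 (sub_ne_zero.2 (Ne.symm hy))
      positivity
    · have : Nonempty (Fin d) := ⟨⟨0, by omega⟩⟩
      obtain ⟨w, hw⟩ := exists_norm_eq (EuclideanSpace ℝ (Fin d))
        (by positivity : 0 ≤ a * (|R| + |R|))
      refine ⟨Wfun d w, Wfun_pos hd2 w, fun x hx y hy => Wfun_anti hd2 ?_⟩
      rw [hw, norm_smul, Real.norm_of_nonneg (le_of_lt ha)]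
      refine mul_le_mul_of_nonneg_left ((norm_sub_le x y).trans ?_) (le_of_lt ha)
      exact add_le_add ((hR x hx).trans (le_abs_self R)) ((hR y hy).trans (le_abs_self R))
  have hsum := hboundary.add ((tendsto_volumeTerm hd hΩ.2.2.1).const_mul 4)
  rw [mul_zero, add_zero] at hsum
  convert hsum using 1
  · funext a
    unfold Phi
    congr 1
    refine integral_congr_ae (ae_of_all _ fun x => integral_congr_ae (ae_of_all _ fun y => ?_))
    beta_reduce
    ring
  · congr 2
    refine integral_congr_ae (ae_of_all _ fun x => integral_congr_ae (ae_of_all _ fun y => ?_))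
    beta_reduce
    ring
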